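/- arXiv:1203.4553 — 2 statements merged into one kernel-verified Lean document; each statement's English description precedes it below -/
import Mathlib

section
/- Suppose α is an isophote with axis d and angle θ, and suppose k_n(s)² + τ_g(s)² > 0 for all s. Then sin θ ≠ 0, the function μ(s) := (k_g(s)·(k_n(s)² + τ_g(s)²) + k_n(s)·τ_g'(s) − k_n'(s)·τ_g(s)) / (k_n(s)² + τ_g(s)²)^{3/2} is constant, and sin²θ · μ(s)² = cos²θ for all s. -/
open scoped RealInnerProductSpace

noncomputable section

/-- The cross product on `EuclideanSpace ℝ (Fin 3)`. -/
def cross3 (u v : EuclideanSpace ℝ (Fin 3)) : EuclideanSpace ℝ (Fin 3) :=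
  (EuclideanSpace.equiv (Fin 3) ℝ).symm
    (crossProduct ((EuclideanSpace.equiv (Fin 3) ℝ) u) ((EuclideanSpace.equiv (Fin 3) ℝ) v))

/-- The coordinates of the cross product. -/
theorem cross3_eq (u v : EuclideanSpace ℝ (Fin 3)) :
    cross3 u v = !₂[u 1 * v 2 - u 2 * v 1, u 2 * v 0 - u 0 * v 2, u 0 * v 1 - u 1 * v 0] := by
  ext i
  fin_cases i <;> simp [cross3, cross_apply]

theorem inner_cross3_self_left (u v : EuclideanSpace ℝ (Fin 3)) : ⟪cross3 u v, u⟫ = 0 := by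
  simp only [cross3_eq, PiLp.inner_apply, Fin.sum_univ_three]
  simp
  ring

theorem inner_cross3_self_right (u v : EuclideanSpace ℝ (Fin 3)) : ⟪cross3 u v, v⟫ = 0 := by
  simp only [cross3_eq, PiLp.inner_apply, Fin.sum_univ_three]
  simp
  ring

/-- Lagrange's identity. -/
theorem inner_cross3_cross3_self (u v : EuclideanSpace ℝ (Fin 3)) :
    ⟪cross3 u v, cross3 u v⟫ = ⟪u, u⟫ * ⟪v, v⟫ - ⟪u, v⟫ ^ 2 := by
  simp only [cross3_eq, PiLp.inner_apply, Fin.sum_univ_three, RCLike.inner_apply, conj_trivial]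
  simp
  ring

theorem ContDiff.cross3 {n : WithTop ℕ∞} {f g : ℝ → EuclideanSpace ℝ (Fin 3)}
    (hf : ContDiff ℝ n f) (hg : ContDiff ℝ n g) : ContDiff ℝ n fun s => cross3 (f s) (g s) := by
  rw [contDiff_euclidean] at hf hg ⊢
  intro i
  simp only [cross3_eq]
  fin_cases i
  · exact ((hf 1).mul (hg 2)).sub ((hf 2).mul (hg 1))
  · exact ((hf 2).mul (hg 0)).sub ((hf 0).mul (hg 2))
  · exact ((hf 0).mul (hg 1)).sub ((hf 1).mul (hg 0))

/-- Parseval's identity for an orthonormal triple in three-dimensional space. -/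
theorem inner_eq_of_orthonormal_triple {e₁ e₂ e₃ : EuclideanSpace ℝ (Fin 3)}
    (h₁₁ : ⟪e₁, e₁⟫ = 1) (h₂₂ : ⟪e₂, e₂⟫ = 1) (h₃₃ : ⟪e₃, e₃⟫ = 1)
    (h₁₂ : ⟪e₁, e₂⟫ = 0) (h₁₃ : ⟪e₁, e₃⟫ = 0) (h₂₃ : ⟪e₂, e₃⟫ = 0)
    (x y : EuclideanSpace ℝ (Fin 3)) :
    ⟪x, y⟫ = ⟪x, e₁⟫ * ⟪e₁, y⟫ + ⟪x, e₂⟫ * ⟪e₂, y⟫ + ⟪x, e₃⟫ * ⟪e₃, y⟫ := by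
  have ho : Orthonormal ℝ ![e₁, e₂, e₃] := by
    rw [orthonormal_iff_ite]
    intro i j
    fin_cases i <;> fin_cases j <;>
      simp [-inner_self_eq_norm_sq_to_K, h₁₁, h₂₂, h₃₃, h₁₂, h₁₃, h₂₃,
        real_inner_comm e₁ e₂, real_inner_comm e₁ e₃, real_inner_comm e₂ e₃]
  let b := (basisOfOrthonormalOfCardEqFinrank ho (by simp)).toOrthonormalBasis (by simpa using ho)
  have hb := b.sum_inner_mul_inner x y
  simpa [b, Fin.sum_univ_three] using hb.symm

/-- Differentiating a constant inner product. -/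
theorem inner_deriv_add_inner_deriv_eq_zero {E : Type*} [NormedAddCommGroup E]
    [InnerProductSpace ℝ E] {f g : ℝ → E} (hf : Differentiable ℝ f) (hg : Differentiable ℝ g)
    {c : ℝ} (h : ∀ s, ⟪f s, g s⟫ = c) (s : ℝ) : ⟪f s, deriv g s⟫ + ⟪deriv f s, g s⟫ = 0 := by
  have hd := (hf s).hasDerivAt.inner ℝ (hg s).hasDerivAt
  simp only [h] at hd
  exact hd.unique (hasDerivAt_const s c)

/-- A continuous real function with constant square is constant. -/
theorem eq_of_continuous_of_sq_eq {f : ℝ → ℝ} (hf : Continuous f) {c : ℝ}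
    (h : ∀ s, f s ^ 2 = c) (s t : ℝ) : f s = f t := by
  by_cases hc : f s = 0
  · have ht : f t ^ 2 = 0 := by rw [h t, ← h s, hc, zero_pow two_ne_zero]
    rw [hc, pow_eq_zero_iff two_ne_zero |>.1 ht]
  · rcases isPreconnected_univ.eq_or_eq_neg_of_sq_eq hf.continuousOn
      (continuousOn_const (c := f s)) (fun x _ => by simp [h]) (fun _ => hc) with h' | h'
    · exact (h' (Set.mem_univ t)).symm
    · have := h' (Set.mem_univ s)
      simp only [Pi.neg_apply] at this
      exact absurd (by linarith) hc

theorem stmt1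
    (α N : ℝ → EuclideanSpace ℝ (Fin 3))
    (hα : ContDiff ℝ (⊤ : ℕ∞) α) (hN : ContDiff ℝ (⊤ : ℕ∞) N)
    (hunit : ∀ s, ‖deriv α s‖ = 1)
    (hNunit : ∀ s, ‖N s‖ = 1)
    (hNT : ∀ s, ⟪N s, deriv α s⟫ = 0)
    (T B : ℝ → EuclideanSpace ℝ (Fin 3))
    (hT : ∀ s, T s = deriv α s)
    (hB : ∀ s, B s = cross3 (N s) (T s))
    (kn kg τg : ℝ → ℝ)
    (hkn : ∀ s, kn s = ⟪deriv T s, N s⟫)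
    (hkg : ∀ s, kg s = ⟪deriv T s, B s⟫)
    (hτg : ∀ s, τg s = ⟪deriv B s, N s⟫)
    (d : EuclideanSpace ℝ (Fin 3)) (hd : ‖d‖ = 1) (θ : ℝ)
    (hiso : ∀ s, ⟪N s, d⟫ = Real.cos θ)
    (μ : ℝ → ℝ)
    (hμ : ∀ s, μ s = (kg s * (kn s ^ 2 + τg s ^ 2) + kn s * deriv τg s - deriv kn s * τg s) /
      Real.sqrt ((kn s ^ 2 + τg s ^ 2) ^ 3))
    (hpos : ∀ s, 0 < kn s ^ 2 + τg s ^ 2) :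
    Real.sin θ ≠ 0 ∧ (∀ s t, μ s = μ t) ∧
      ∀ s, Real.sin θ ^ 2 * μ s ^ 2 = Real.cos θ ^ 2 := by
  obtain rfl : T = deriv α := funext hT
  have hTs : ContDiff ℝ (⊤ : ℕ∞) (deriv α) := (contDiff_infty_iff_deriv.1 hα).2
  have hBs : ContDiff ℝ (⊤ : ℕ∞) B := by
    rw [funext hB]
    exact hN.cross3 hTs
  have hT's : ContDiff ℝ (⊤ : ℕ∞) (deriv (deriv α)) := (contDiff_infty_iff_deriv.1 hTs).2
  have hB's : ContDiff ℝ (⊤ : ℕ∞) (deriv B) := (contDiff_infty_iff_deriv.1 hBs).2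
  have hkns : ContDiff ℝ (⊤ : ℕ∞) kn := by
    rw [funext hkn]
    exact hT's.inner ℝ hN
  have hkgs : ContDiff ℝ (⊤ : ℕ∞) kg := by
    rw [funext hkg]
    exact hT's.inner ℝ hBs
  have hτgs : ContDiff ℝ (⊤ : ℕ∞) τg := by
    rw [funext hτg]
    exact hB's.inner ℝ hN
  have hne : ((⊤ : ℕ∞) : WithTop ℕ∞) ≠ 0 := by simp
  have dT := hTs.differentiable hne
  have dN := hN.differentiable hne
  have dB := hBs.differentiable hne
  have dkn := hkns.differentiable hne
  have dτg := hτgs.differentiable hne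
  have hTT s : ⟪deriv α s, deriv α s⟫ = 1 := by simp [hunit]
  have hNN s : ⟪N s, N s⟫ = 1 := by simp [hNunit]
  have hBN s : ⟪B s, N s⟫ = 0 := by rw [hB, inner_cross3_self_left]
  have hBT s : ⟪B s, deriv α s⟫ = 0 := by rw [hB, inner_cross3_self_right]
  have hBB s : ⟪B s, B s⟫ = 1 := by
    rw [hB, inner_cross3_cross3_self, hTT, hNN, hNT]
    norm_num
  have parseval s := inner_eq_of_orthonormal_triple (hBB s) (hNN s) (hTT s) (hBN s) (hBT s) (hNT s)
  have hN'T s : ⟪deriv N s, deriv α s⟫ = -kn s := by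
    have := inner_deriv_add_inner_deriv_eq_zero dN dT hNT s
    rw [hkn]
    linarith [real_inner_comm (N s) (deriv (deriv α) s)]
  have hN'B s : ⟪deriv N s, B s⟫ = -τg s := by
    have := inner_deriv_add_inner_deriv_eq_zero dB dN hBN s
    rw [real_inner_comm, ← hτg] at this
    linarith
  have hN'N s : ⟪deriv N s, N s⟫ = 0 := by
    have := inner_deriv_add_inner_deriv_eq_zero dN dN hNN s
    linarith [real_inner_comm (N s) (deriv N s)]
  have hT'T s : ⟪deriv (deriv α) s, deriv α s⟫ = 0 := by
    have := inner_deriv_add_inner_deriv_eq_zero dT dT hTT s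
    linarith [real_inner_comm (deriv α s) (deriv (deriv α) s)]
  have hB'B s : ⟪deriv B s, B s⟫ = 0 := by
    have := inner_deriv_add_inner_deriv_eq_zero dB dB hBB s
    linarith [real_inner_comm (B s) (deriv B s)]
  have hB'T s : ⟪deriv B s, deriv α s⟫ = -kg s := by
    have := inner_deriv_add_inner_deriv_eq_zero dB dT hBT s
    rw [hkg]
    linarith [real_inner_comm (B s) (deriv (deriv α) s)]
  have hN'd s : kn s * ⟪deriv α s, d⟫ + τg s * ⟪B s, d⟫ = 0 := by
    have := inner_deriv_add_inner_deriv_eq_zero dN (differentiable_const d) hiso s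
    rw [deriv_const, inner_zero_right, parseval s (deriv N s) d, hN'B, hN'N, hN'T] at this
    linarith
  have hTd s : HasDerivAt (fun s => ⟪deriv α s, d⟫) (kg s * ⟪B s, d⟫ + kn s * Real.cos θ) s := by
    have := (dT s).hasDerivAt.inner ℝ (hasDerivAt_const s d)
    rw [inner_zero_right, parseval s (deriv (deriv α) s) d, ← hkg, ← hkn, hT'T, hiso] at this
    exact this.congr_deriv (by ring)
  have hBd s : HasDerivAt (fun s => ⟪B s, d⟫)
      (-kg s * ⟪deriv α s, d⟫ + τg s * Real.cos θ) s := by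
    have := (dB s).hasDerivAt.inner ℝ (hasDerivAt_const s d)
    rw [inner_zero_right, parseval s (deriv B s) d, hB'B, ← hτg, hB'T, hiso] at this
    exact this.congr_deriv (by ring)
  have hN''d s : deriv kn s * ⟪deriv α s, d⟫ + kn s * (kg s * ⟪B s, d⟫ + kn s * Real.cos θ) +
      (deriv τg s * ⟪B s, d⟫ + τg s * (-kg s * ⟪deriv α s, d⟫ + τg s * Real.cos θ)) = 0 := by
    have := ((dkn s).hasDerivAt.mul (hTd s)).add ((dτg s).hasDerivAt.mul (hBd s))
    refine this.unique ((hasDerivAt_const s (0 : ℝ)).congr_of_eventuallyEq ?_)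
    exact Filter.Eventually.of_forall hN'd
  have hdd s : ⟪deriv α s, d⟫ ^ 2 + ⟪B s, d⟫ ^ 2 = Real.sin θ ^ 2 := by
    have := parseval s d d
    rw [real_inner_self_eq_norm_sq, hd, real_inner_comm (B s), real_inner_comm (N s),
      real_inner_comm (deriv α s), hiso] at this
    linarith [Real.sin_sq_add_cos_sq θ]
  have key s : Real.sin θ ^ 2 *
      (kg s * (kn s ^ 2 + τg s ^ 2) + kn s * deriv τg s - deriv kn s * τg s) ^ 2 =
      Real.cos θ ^ 2 * (kn s ^ 2 + τg s ^ 2) ^ 3 := by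
    have hw := (hpos s).ne'
    have h₁ := hN'd s
    have h₂ := hN''d s
    have h₃ := hdd s
    generalize ⟪deriv α s, d⟫ = a at *
    generalize ⟪B s, d⟫ = b at *
    obtain ⟨l, hl⟩ : ∃ l, l * (kn s ^ 2 + τg s ^ 2) = kn s * b - τg s * a :=
      ⟨(kn s * b - τg s * a) / (kn s ^ 2 + τg s ^ 2), div_mul_cancel₀ _ hw⟩
    have ha : a = -l * τg s := mul_right_cancel₀ hw (by linear_combination kn s * h₁ + τg s * hl)
    have hb : b = l * kn s := mul_right_cancel₀ hw (by linear_combination τg s * h₁ - kn s * hl)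
    subst ha hb
    have hM : l * (kg s * (kn s ^ 2 + τg s ^ 2) + kn s * deriv τg s - deriv kn s * τg s) =
        -(Real.cos θ * (kn s ^ 2 + τg s ^ 2)) := by linear_combination h₂
    rw [← h₃]
    linear_combination (kn s ^ 2 + τg s ^ 2) *
      (l * (kg s * (kn s ^ 2 + τg s ^ 2) + kn s * deriv τg s - deriv kn s * τg s) -
        Real.cos θ * (kn s ^ 2 + τg s ^ 2)) * hM
  have hsin : Real.sin θ ≠ 0 := by
    intro h
    have h₀ := key 0
    have hc := Real.sin_sq_add_cos_sq θ
    rw [h] at h₀ hc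
    have : Real.cos θ ^ 2 = 1 := by linarith
    rw [this] at h₀
    have := pow_pos (hpos 0) 3
    linarith
  have hμsq s : Real.sin θ ^ 2 * μ s ^ 2 = Real.cos θ ^ 2 := by
    have hw := pow_pos (hpos s) 3
    rw [hμ, div_pow, Real.sq_sqrt hw.le, ← mul_div_assoc, key, mul_div_cancel_right₀ _ hw.ne']
  have hμc : Continuous μ := by
    have := hkns.continuous
    have := hkgs.continuous
    have := hτgs.continuous
    have := (contDiff_infty_iff_deriv.1 hkns).2.continuous
    have := (contDiff_infty_iff_deriv.1 hτgs).2.continuous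
    rw [funext hμ]
    refine Continuous.div (by fun_prop) (by fun_prop) fun s => ?_
    exact (Real.sqrt_pos.2 (pow_pos (hpos s) 3)).ne'
  refine ⟨hsin, eq_of_continuous_of_sq_eq (c := Real.cos θ ^ 2 / Real.sin θ ^ 2) hμc fun s => ?_,
    hμsq⟩
  rw [eq_div_iff (pow_ne_zero 2 hsin), mul_comm, hμsq]
end
end

section
/- Suppose α is a silhouette curve with axis d (i.e. d is a unit vector with ⟪N(s), d⟫ = 0 for all s), κ(s) > 0 for all s, and k_n(s) ≠ 0 for all s. Then k_g(s) = 0 for all s (α is a geodesic) if and only if ⟪n(s), d⟫ = 0 for all s (the axis d lies in the rectifying plane spanned by T(s) and b(s)). -/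
open scoped RealInnerProductSpace

noncomputable section

/-- The Gram determinant of `(u, v, x)` against `(u, v, y)` factors as a product of two
triple products. -/
theorem inner_cross3_mul_inner_cross3 (u v x y : EuclideanSpace ℝ (Fin 3)) :
    ⟪x, cross3 u v⟫ * ⟪y, cross3 u v⟫ =
      ⟪u, u⟫ * (⟪v, v⟫ * ⟪x, y⟫ - ⟪v, y⟫ * ⟪x, v⟫)
        - ⟪u, v⟫ * (⟪u, v⟫ * ⟪x, y⟫ - ⟪v, y⟫ * ⟪x, u⟫)
        + ⟪u, y⟫ * (⟪u, v⟫ * ⟪x, v⟫ - ⟪v, v⟫ * ⟪x, u⟫) := by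
  simp only [PiLp.inner_apply, Fin.sum_univ_three]
  simp [cross3, cross_apply]
  ring

/-- Parseval's identity in the orthonormal frame `u, v, u × v`. -/
theorem inner_eq_of_orthonormal_cross3 {u v : EuclideanSpace ℝ (Fin 3)} (hu : ‖u‖ = 1)
    (hv : ‖v‖ = 1) (huv : ⟪u, v⟫ = 0) (x y : EuclideanSpace ℝ (Fin 3)) :
    ⟪x, y⟫ = ⟪u, x⟫ * ⟪u, y⟫ + ⟪v, x⟫ * ⟪v, y⟫ + ⟪x, cross3 u v⟫ * ⟪y, cross3 u v⟫ := by
  rw [inner_cross3_mul_inner_cross3, huv, real_inner_self_eq_norm_sq, real_inner_self_eq_norm_sq,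
    hu, hv, real_inner_comm u x, real_inner_comm v x]
  ring

theorem stmt11
    (α N : ℝ → EuclideanSpace ℝ (Fin 3))
    (hα : ContDiff ℝ (⊤ : ℕ∞) α) (hN : ContDiff ℝ (⊤ : ℕ∞) N)
    (hunit : ∀ s, ‖deriv α s‖ = 1)
    (hNunit : ∀ s, ‖N s‖ = 1)
    (hNT : ∀ s, ⟪N s, deriv α s⟫ = 0)
    (T B : ℝ → EuclideanSpace ℝ (Fin 3))
    (hT : ∀ s, T s = deriv α s)
    (hB : ∀ s, B s = cross3 (N s) (T s))
    (kn kg τg : ℝ → ℝ)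
    (hkn : ∀ s, kn s = ⟪deriv T s, N s⟫)
    (hkg : ∀ s, kg s = ⟪deriv T s, B s⟫)
    (hτg : ∀ s, τg s = ⟪deriv B s, N s⟫)
    (κ τ : ℝ → ℝ) (n b : ℝ → EuclideanSpace ℝ (Fin 3))
    (hκ : ∀ s, κ s = ‖deriv (deriv α) s‖)
    (hκpos : ∀ s, 0 < κ s)
    (hn : ∀ s, n s = (κ s)⁻¹ • deriv (deriv α) s)
    (hb : ∀ s, b s = cross3 (deriv α s) (n s))
    (hτ : ∀ s, τ s = ⟪cross3 (deriv α s) (deriv (deriv α) s), deriv (deriv (deriv α)) s⟫ / κ s ^ 2)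
    (d : EuclideanSpace ℝ (Fin 3)) (hd : ‖d‖ = 1)
    (hsil : ∀ s, ⟪N s, d⟫ = 0)
    (hknne : ∀ s, kn s ≠ 0) :
    (∀ s, kg s = 0) ↔ (∀ s, ⟪n s, d⟫ = 0) := by
  obtain rfl : T = deriv α := funext hT
  have hdα : Differentiable ℝ (deriv α) :=
    (contDiff_infty_iff_deriv.1 hα).2.differentiable (by simp)
  have hdN : Differentiable ℝ N := hN.differentiable (by simp)
  have hTT' (s : ℝ) : ⟪deriv α s, deriv (deriv α) s⟫ = 0 := by
    have h := (hdα s).hasDerivAt.inner ℝ (hdα s).hasDerivAt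
    simp only [real_inner_self_eq_norm_sq, hunit] at h
    have := h.unique (hasDerivAt_const s _)
    rw [real_inner_comm (deriv α s)] at this
    linarith
  have hN'T (s : ℝ) : ⟪deriv α s, deriv N s⟫ = -kn s := by
    have h := (hdN s).hasDerivAt.inner ℝ (hdα s).hasDerivAt
    simp only [hNT] at h
    have := h.unique (hasDerivAt_const s _)
    rw [hkn, real_inner_comm, real_inner_comm (N s)]
    linarith
  have hdN' (s : ℝ) : ⟪d, deriv N s⟫ = 0 := by
    have h := (hdN s).hasDerivAt.inner ℝ (hasDerivAt_const s d)
    simp only [hsil, inner_zero_right, zero_add] at h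
    rw [real_inner_comm]
    exact h.unique (hasDerivAt_const s _)
  have parseval (s : ℝ) (x : EuclideanSpace ℝ (Fin 3)) :
      ⟪d, x⟫ = ⟪deriv α s, d⟫ * ⟪deriv α s, x⟫ + ⟪d, B s⟫ * ⟪x, B s⟫ := by
    rw [inner_eq_of_orthonormal_cross3 (hNunit s) (hunit s) (hNT s) d x, hsil, hB]
    ring
  have hnd (s : ℝ) : ⟪n s, d⟫ = (κ s)⁻¹ * (⟪d, B s⟫ * kg s) := by
    rw [hn, real_inner_smul_left, real_inner_comm, parseval s, hTT', hkg]
    ring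
  refine ⟨fun h s => by rw [hnd, h]; ring, fun h s => ?_⟩
  have hs := h s
  rw [hnd] at hs
  rcases mul_eq_zero.1 ((mul_eq_zero.1 hs).resolve_left (inv_pos.2 (hκpos s)).ne') with hdB | hk
  · have hdT : ⟪deriv α s, d⟫ = 0 := by
      have := parseval s (deriv N s)
      rw [hdN', hdB, hN'T] at this
      simpa [hknne s] using this
    have := parseval s d
    rw [real_inner_self_eq_norm_sq, hd, hdT, hdB] at this
    norm_num at this
  · exact hk
end
end
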